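/- For every integer k ≥ 2, there does not exist a spherical latin bitrade whose canonical group is isomorphic to (Z_2)^k, the direct sum of k copies of the cyclic group of order 2. -/

import Mathlib

/-- A partial latin square on row set `R`, column set `C` and symbol set `S` (given as
pairwise disjoint types): a finite set of triples such that any two distinct triples agree
in at most one coordinate, and every row, column and symbol occurs in some triple. -/
def IsPartialLatinSquare {R C S : Type} (P : Finset (R × C × S)) : Prop :=
  (∀ t₁ ∈ P, ∀ t₂ ∈ P, t₁ ≠ t₂ →
      ¬(t₁.1 = t₂.1 ∧ t₁.2.1 = t₂.2.1) ∧
      ¬(t₁.1 = t₂.1 ∧ t₁.2.2 = t₂.2.2) ∧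
      ¬(t₁.2.1 = t₂.2.1 ∧ t₁.2.2 = t₂.2.2)) ∧
  (∀ r : R, ∃ t ∈ P, t.1 = r) ∧
  (∀ c : C, ∃ t ∈ P, t.2.1 = c) ∧
  (∀ s : S, ∃ t ∈ P, t.2.2 = s)

/-- The latin bitrade condition: for each triple `(r,c,s) ∈ W` there are unique
`r' ≠ r`, `c' ≠ c`, `s' ≠ s` with `(r',c,s), (r,c',s), (r,c,s') ∈ B`. -/
def TradeCond {R C S : Type} (W B : Finset (R × C × S)) : Prop :=
  ∀ t ∈ W,
    (∃! r' : R, r' ≠ t.1 ∧ (r', t.2.1, t.2.2) ∈ B) ∧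
    (∃! c' : C, c' ≠ t.2.1 ∧ (t.1, c', t.2.2) ∈ B) ∧
    (∃! s' : S, s' ≠ t.2.2 ∧ (t.1, t.2.1, s') ∈ B)

/-- A spherical latin bitrade: a connected latin bitrade `(W,B)` on finite row, column and
symbol sets `R`, `C`, `S` with `|R| + |C| + |S| = |W| + 2`.  (Connectedness says there is no
latin bitrade `(W',B')` with `W' ⊊ W` and `B' ⊊ B`; for subsets of `W` and `B` the
"agree in at most one coordinate" condition is inherited, and the occurrence condition is
automatic on the sets of rows, columns and symbols actually occupied, so the substantive
conditions on a sub-bitrade are nonemptiness and the two trade conditions.) -/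
structure SphericalLatinBitrade where
  R : Type
  C : Type
  S : Type
  instR : Fintype R
  instC : Fintype C
  instS : Fintype S
  W : Finset (R × C × S)
  B : Finset (R × C × S)
  W_nonempty : W.Nonempty
  B_nonempty : B.Nonempty
  W_pls : IsPartialLatinSquare W
  B_pls : IsPartialLatinSquare B
  tradeWB : TradeCond W B
  tradeBW : TradeCond B W
  connected : ¬ ∃ (W' B' : Finset (R × C × S)), W' ⊂ W ∧ B' ⊂ B ∧
      W'.Nonempty ∧ B'.Nonempty ∧ TradeCond W' B' ∧ TradeCond B' W'
  spherical : @Fintype.card R instR + @Fintype.card C instC + @Fintype.card S instS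
      = W.card + 2

/-- The subgroup of relations `r + c + s = 0`, for `(r,c,s) ∈ W`, in the free abelian group
on `R ⊔ C ⊔ S`. -/
def bitradeRelations (T : SphericalLatinBitrade) :
    AddSubgroup (FreeAbelianGroup (T.R ⊕ T.C ⊕ T.S)) :=
  AddSubgroup.closure
    ((fun t : T.R × T.C × T.S =>
        FreeAbelianGroup.of (Sum.inl t.1) +
        FreeAbelianGroup.of (Sum.inr (Sum.inl t.2.1)) +
        FreeAbelianGroup.of (Sum.inr (Sum.inr t.2.2))) '' (T.W : Set (T.R × T.C × T.S)))

/-- The group `A_W`: the free abelian group on `R ⊔ C ⊔ S` modulo the relations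
`r + c + s = 0` for `(r,c,s) ∈ W`. -/
abbrev groupAW (T : SphericalLatinBitrade) : Type :=
  FreeAbelianGroup (T.R ⊕ T.C ⊕ T.S) ⧸ bitradeRelations T

/-- The canonical group of a spherical latin bitrade: the torsion subgroup of `A_W`. -/
abbrev CanonicalGroup (T : SphericalLatinBitrade) : Type :=
  AddCommGroup.torsion (groupAW T)

section Helpers

variable {R C S : Type}

lemma sum_rc {W B : Finset (R × C × S)} (hW : IsPartialLatinSquare W)
    (hB : IsPartialLatinSquare B) (hWB : TradeCond W B) (hBW : TradeCond B W)
    (g : R → C → ℚ) : ∑ t ∈ W, g t.1 t.2.1 = ∑ t ∈ B, g t.1 t.2.1 := by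
  classical
  refine Finset.sum_bij (fun t ht => (t.1, t.2.1, (hWB t ht).2.2.choose)) ?_ ?_ ?_ ?_
  · intro t ht
    exact (hWB t ht).2.2.choose_spec.1.2
  · intro t ht u hu h
    simp only [Prod.mk.injEq] at h
    by_contra hne
    exact (hW.1 t ht u hu hne).1 ⟨h.1, h.2.1⟩
  · intro b hb
    obtain ⟨s', ⟨hs, hm⟩, -⟩ := (hBW b hb).2.2
    refine ⟨_, hm, ?_⟩
    have h2 := (hWB _ hm).2.2.choose_spec.1.2
    by_contra hne
    exact (hB.1 _ h2 b hb hne).1 ⟨rfl, rfl⟩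
  · intro t ht
    rfl

lemma sum_rs {W B : Finset (R × C × S)} (hW : IsPartialLatinSquare W)
    (hB : IsPartialLatinSquare B) (hWB : TradeCond W B) (hBW : TradeCond B W)
    (g : R → S → ℚ) : ∑ t ∈ W, g t.1 t.2.2 = ∑ t ∈ B, g t.1 t.2.2 := by
  classical
  refine Finset.sum_bij (fun t ht => (t.1, (hWB t ht).2.1.choose, t.2.2)) ?_ ?_ ?_ ?_
  · intro t ht
    exact (hWB t ht).2.1.choose_spec.1.2
  · intro t ht u hu h
    simp only [Prod.mk.injEq] at h
    by_contra hne
    exact (hW.1 t ht u hu hne).2.1 ⟨h.1, h.2.2⟩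
  · intro b hb
    obtain ⟨s', ⟨hs, hm⟩, -⟩ := (hBW b hb).2.1
    refine ⟨_, hm, ?_⟩
    have h2 := (hWB _ hm).2.1.choose_spec.1.2
    by_contra hne
    exact (hB.1 _ h2 b hb hne).2.1 ⟨rfl, rfl⟩
  · intro t ht
    rfl

lemma sum_cs {W B : Finset (R × C × S)} (hW : IsPartialLatinSquare W)
    (hB : IsPartialLatinSquare B) (hWB : TradeCond W B) (hBW : TradeCond B W)
    (g : C → S → ℚ) : ∑ t ∈ W, g t.2.1 t.2.2 = ∑ t ∈ B, g t.2.1 t.2.2 := by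
  classical
  refine Finset.sum_bij (fun t ht => ((hWB t ht).1.choose, t.2.1, t.2.2)) ?_ ?_ ?_ ?_
  · intro t ht
    exact (hWB t ht).1.choose_spec.1.2
  · intro t ht u hu h
    simp only [Prod.mk.injEq] at h
    by_contra hne
    exact (hW.1 t ht u hu hne).2.2 ⟨h.2.1, h.2.2⟩
  · intro b hb
    obtain ⟨s', ⟨hs, hm⟩, -⟩ := (hBW b hb).1
    refine ⟨_, hm, ?_⟩
    have h2 := (hWB _ hm).1.choose_spec.1.2
    by_contra hne
    exact (hB.1 _ h2 b hb hne).2.2 ⟨rfl, rfl⟩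
  · intro t ht
    rfl

/-- Two triples agree in at least two coordinates. -/
def Adj2 (t u : R × C × S) : Prop :=
  (t.1 = u.1 ∧ t.2.1 = u.2.1) ∨ (t.1 = u.1 ∧ t.2.2 = u.2.2) ∨ (t.2.1 = u.2.1 ∧ t.2.2 = u.2.2)

lemma tradeCond_filter {W B : Finset (R × C × S)} (hWB : TradeCond W B)
    (p : R × C × S → Prop) [DecidablePred p]
    (hp : ∀ t ∈ W, ∀ u ∈ B, Adj2 t u → (p t ↔ p u)) :
    TradeCond (W.filter p) (B.filter p) := by
  intro t ht
  rw [Finset.mem_filter] at ht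
  obtain ⟨h1, h2, h3⟩ := hWB t ht.1
  refine ⟨?_, ?_, ?_⟩
  · obtain ⟨x, ⟨hx, hm⟩, hu⟩ := h1
    refine ⟨x, ⟨hx, Finset.mem_filter.2 ⟨hm, ?_⟩⟩, ?_⟩
    · exact (hp t ht.1 _ hm (Or.inr (Or.inr ⟨rfl, rfl⟩))).1 ht.2
    · exact fun y hy => hu y ⟨hy.1, (Finset.mem_filter.1 hy.2).1⟩
  · obtain ⟨x, ⟨hx, hm⟩, hu⟩ := h2
    refine ⟨x, ⟨hx, Finset.mem_filter.2 ⟨hm, ?_⟩⟩, ?_⟩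
    · exact (hp t ht.1 _ hm (Or.inr (Or.inl ⟨rfl, rfl⟩))).1 ht.2
    · exact fun y hy => hu y ⟨hy.1, (Finset.mem_filter.1 hy.2).1⟩
  · obtain ⟨x, ⟨hx, hm⟩, hu⟩ := h3
    refine ⟨x, ⟨hx, Finset.mem_filter.2 ⟨hm, ?_⟩⟩, ?_⟩
    · exact (hp t ht.1 _ hm (Or.inl ⟨rfl, rfl⟩)).1 ht.2
    · exact fun y hy => hu y ⟨hy.1, (Finset.mem_filter.1 hy.2).1⟩

lemma all_of_connected (T : SphericalLatinBitrade) (p : T.R × T.C × T.S → Prop)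
    (hp : ∀ t ∈ T.W, ∀ u ∈ T.B, Adj2 t u → (p t ↔ p u))
    (t₀ : T.R × T.C × T.S) (h₀ : t₀ ∈ T.W) (hp₀ : p t₀) : ∀ t ∈ T.W, p t := by
  classical
  have hp' : ∀ t ∈ T.B, ∀ u ∈ T.W, Adj2 t u → (p t ↔ p u) := by
    intro t ht u hu h
    refine (hp u hu t ht ?_).symm
    unfold Adj2 at *
    tauto
  by_contra hcon
  push Not at hcon
  obtain ⟨t₁, h₁, hp₁⟩ := hcon
  obtain ⟨x₀, ⟨-, hx₀⟩, -⟩ := (T.tradeWB t₀ h₀).1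
  obtain ⟨x₁, ⟨-, hx₁⟩, -⟩ := (T.tradeWB t₁ h₁).1
  have q₀ := (hp _ h₀ _ hx₀ (Or.inr (Or.inr ⟨rfl, rfl⟩))).1 hp₀
  have q₁ := mt (hp _ h₁ _ hx₁ (Or.inr (Or.inr ⟨rfl, rfl⟩))).2 hp₁
  refine T.connected ⟨T.W.filter p, T.B.filter p, ?_, ?_, ⟨t₀, ?_⟩,
    ⟨(x₀, t₀.2.1, t₀.2.2), ?_⟩,
    tradeCond_filter T.tradeWB p hp, tradeCond_filter T.tradeBW p hp'⟩
  · exact Finset.filter_ssubset.2 ⟨t₁, h₁, hp₁⟩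
  · exact Finset.filter_ssubset.2 ⟨_, hx₁, q₁⟩
  · exact Finset.mem_filter.2 ⟨h₀, hp₀⟩
  · exact Finset.mem_filter.2 ⟨hx₀, q₀⟩

lemma sum_sq_eq {W B : Finset (R × C × S)} (hW : IsPartialLatinSquare W)
    (hB : IsPartialLatinSquare B) (hWB : TradeCond W B) (hBW : TradeCond B W)
    (f : R → ℚ) (g : C → ℚ) (h : S → ℚ) :
    ∑ t ∈ W, (f t.1 + g t.2.1 + h t.2.2) ^ 2 = ∑ t ∈ B, (f t.1 + g t.2.1 + h t.2.2) ^ 2 := by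
  have e : ∀ P : Finset (R × C × S), ∑ t ∈ P, (f t.1 + g t.2.1 + h t.2.2) ^ 2 =
      ∑ t ∈ P, (f t.1 + g t.2.1) ^ 2 + ∑ t ∈ P, (h t.2.2 ^ 2 + 2 * f t.1 * h t.2.2)
        + ∑ t ∈ P, 2 * g t.2.1 * h t.2.2 := by
    intro P
    rw [← Finset.sum_add_distrib, ← Finset.sum_add_distrib]
    exact Finset.sum_congr rfl fun t _ => by ring
  rw [e, e, sum_rc hW hB hWB hBW (fun r c => (f r + g c) ^ 2),
    sum_rs hW hB hWB hBW (fun r s => h s ^ 2 + 2 * f r * h s),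
    sum_cs hW hB hWB hBW (fun c s => 2 * g c * h s)]

lemma black_zero (T : SphericalLatinBitrade) (f : T.R → ℚ) (g : T.C → ℚ) (h : T.S → ℚ)
    (h0 : ∀ t ∈ T.W, f t.1 + g t.2.1 + h t.2.2 = 0) :
    ∀ t ∈ T.B, f t.1 + g t.2.1 + h t.2.2 = 0 := by
  have e := sum_sq_eq T.W_pls T.B_pls T.tradeWB T.tradeBW f g h
  rw [Finset.sum_eq_zero (fun t ht => by rw [h0 t ht]; norm_num), eq_comm,
    Finset.sum_eq_zero_iff_of_nonneg (fun _ _ => sq_nonneg _)] at e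
  intro t ht
  exact pow_eq_zero_iff (two_ne_zero) |>.1 (e t ht)

lemma const_of_ker (T : SphericalLatinBitrade) (f : T.R → ℚ) (g : T.C → ℚ) (h : T.S → ℚ)
    (h0 : ∀ t ∈ T.W, f t.1 + g t.2.1 + h t.2.2 = 0)
    (t₀ : T.R × T.C × T.S) (h₀ : t₀ ∈ T.W) :
    (∀ r, f r = f t₀.1) ∧ (∀ c, g c = g t₀.2.1) ∧ (∀ s, h s = h t₀.2.2) := by
  have hb := black_zero T f g h h0
  refine ⟨fun r => ?_, fun r => ?_, fun r => ?_⟩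
  · have := all_of_connected T (fun t => f t.1 = f t₀.1) ?_ t₀ h₀ rfl
    · obtain ⟨t, ht, rfl⟩ := T.W_pls.2.1 r
      exact this t ht
    · intro t ht u hu hadj
      have e1 := h0 t ht
      have e2 := hb u hu
      have : f t.1 = f u.1 := by
        rcases hadj with ⟨ha, -⟩ | ⟨ha, -⟩ | ⟨ha, hc⟩
        · rw [ha]
        · rw [ha]
        · rw [ha, hc] at e1; linarith
      simp only [this]
  · have := all_of_connected T (fun t => g t.2.1 = g t₀.2.1) ?_ t₀ h₀ rfl
    · obtain ⟨t, ht, rfl⟩ := T.W_pls.2.2.1 r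
      exact this t ht
    · intro t ht u hu hadj
      have e1 := h0 t ht
      have e2 := hb u hu
      have : g t.2.1 = g u.2.1 := by
        rcases hadj with ⟨-, ha⟩ | ⟨ha, hc⟩ | ⟨ha, -⟩
        · rw [ha]
        · rw [ha, hc] at e1; linarith
        · rw [ha]
      simp only [this]
  · have := all_of_connected T (fun t => h t.2.2 = h t₀.2.2) ?_ t₀ h₀ rfl
    · obtain ⟨t, ht, rfl⟩ := T.W_pls.2.2.2 r
      exact this t ht
    · intro t ht u hu hadj
      have e1 := h0 t ht
      have e2 := hb u hu
      have : h t.2.2 = h u.2.2 := by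
        rcases hadj with ⟨ha, hc⟩ | ⟨-, ha⟩ | ⟨-, ha⟩
        · rw [ha, hc] at e1; linarith
        · rw [ha]
        · rw [ha]
      simp only [this]

/-- Incidence of a triple with a row, column or symbol. -/
def inc [DecidableEq R] [DecidableEq C] [DecidableEq S] (t : R × C × S) : R ⊕ C ⊕ S → ℚ :=
  Sum.elim (fun r => if t.1 = r then 1 else 0)
    (Sum.elim (fun c => if t.2.1 = c then 1 else 0) (fun s => if t.2.2 = s then 1 else 0))

/-- The incidence matrix of a set of triples. -/
def incMat [DecidableEq R] [DecidableEq C] [DecidableEq S] (P : Finset (R × C × S)) :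
    Matrix P (R ⊕ C ⊕ S) ℚ := Matrix.of fun t v => inc t.1 v

lemma incMat_mulVec [DecidableEq R] [DecidableEq C] [DecidableEq S]
    [Fintype R] [Fintype C] [Fintype S] (P : Finset (R × C × S)) (f : R ⊕ C ⊕ S → ℚ) (t : P) :
    (incMat P).mulVec f t = f (Sum.inl t.1.1) + f (Sum.inr (Sum.inl t.1.2.1))
      + f (Sum.inr (Sum.inr t.1.2.2)) := by
  simp [incMat, Matrix.mulVec, dotProduct, inc, Fintype.sum_sum_type, add_assoc]

lemma gram_eq [DecidableEq R] [DecidableEq C] [DecidableEq S]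
    {W B : Finset (R × C × S)} (hW : IsPartialLatinSquare W)
    (hB : IsPartialLatinSquare B) (hWB : TradeCond W B) (hBW : TradeCond B W) :
    (incMat W).transpose * incMat W = (incMat B).transpose * incMat B := by
  ext u v
  simp only [Matrix.mul_apply, Matrix.transpose_apply, incMat, Matrix.of_apply]
  rw [Finset.sum_coe_sort W (fun t => inc t u * inc t v),
    Finset.sum_coe_sort B (fun t => inc t u * inc t v)]
  have h1 := sum_rc hW hB hWB hBW
  have h2 := sum_rs hW hB hWB hBW
  have h3 := sum_cs hW hB hWB hBW
  rcases u with u | u | u <;> rcases v with v | v | v <;> simp only [inc, Sum.elim_inl, Sum.elim_inr]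
  · exact h1 (fun r _ => (if r = u then 1 else 0) * (if r = v then 1 else 0))
  · exact h1 (fun r c => (if r = u then 1 else 0) * (if c = v then 1 else 0))
  · exact h2 (fun r c => (if r = u then 1 else 0) * (if c = v then 1 else 0))
  · exact h1 (fun r c => (if c = u then 1 else 0) * (if r = v then 1 else 0))
  · exact h1 (fun r c => (if c = u then 1 else 0) * (if c = v then 1 else 0))
  · exact h3 (fun r c => (if r = u then 1 else 0) * (if c = v then 1 else 0))
  · exact h2 (fun r c => (if c = u then 1 else 0) * (if r = v then 1 else 0))
  · exact h3 (fun r c => (if c = u then 1 else 0) * (if r = v then 1 else 0))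
  · exact h2 (fun r c => (if c = u then 1 else 0) * (if c = v then 1 else 0))

lemma exists_right_inv (T : SphericalLatinBitrade) [DecidableEq T.R] [DecidableEq T.C]
    [DecidableEq T.S] [Fintype T.R] [Fintype T.C] [Fintype T.S] :
    ∃ P : Matrix (T.R ⊕ T.C ⊕ T.S) T.W ℚ, incMat T.W * P = 1 := by
  rw [← Matrix.mulVec_surjective_iff_exists_right_inverse]
  obtain ⟨t₀, h₀⟩ := T.W_nonempty
  let F := (incMat T.W).mulVecLin
  have hker : Module.finrank ℚ (LinearMap.ker F) ≤ 2 := by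
    let G : (LinearMap.ker F) →ₗ[ℚ] ℚ × ℚ :=
      ((LinearMap.proj (Sum.inl t₀.1)).prod
        (LinearMap.proj (R := ℚ) (φ := fun _ : T.R ⊕ T.C ⊕ T.S => ℚ)
          (Sum.inr (Sum.inl t₀.2.1)))).comp (LinearMap.ker F).subtype
    have hG : Function.Injective G := by
      rw [← LinearMap.ker_eq_bot, LinearMap.ker_eq_bot']
      rintro ⟨f, hf⟩ hGf
      have hf' : ∀ t ∈ T.W, f (Sum.inl t.1) + f (Sum.inr (Sum.inl t.2.1))
          + f (Sum.inr (Sum.inr t.2.2)) = 0 := by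
        intro t ht
        rw [← incMat_mulVec T.W f ⟨t, ht⟩]
        exact congrFun (LinearMap.mem_ker.1 hf) ⟨t, ht⟩
      have hc := const_of_ker T (fun r => f (Sum.inl r)) (fun c => f (Sum.inr (Sum.inl c)))
        (fun s => f (Sum.inr (Sum.inr s))) hf' t₀ h₀
      have e1 : f (Sum.inl t₀.1) = 0 := congrArg Prod.fst hGf
      have e2 : f (Sum.inr (Sum.inl t₀.2.1)) = 0 := congrArg Prod.snd hGf
      have e3 := hf' t₀ h₀
      ext v
      rcases v with v | v | v
      · simpa [e1] using hc.1 v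
      · simpa [e2] using hc.2.1 v
      · have := hc.2.2 v
        change f _ = 0
        rw [this]
        linarith
    have := LinearMap.finrank_le_finrank_of_injective hG
    simpa using this
  have hrn := LinearMap.finrank_range_add_finrank_ker F
  have hsp := T.spherical
  rw [Module.finrank_fintype_fun_eq_card, Fintype.card_sum, Fintype.card_sum] at hrn
  have i1 : @Fintype.card T.R T.instR = Fintype.card T.R := by congr; exact Subsingleton.elim _ _
  have i2 : @Fintype.card T.C T.instC = Fintype.card T.C := by congr; exact Subsingleton.elim _ _
  have i3 : @Fintype.card T.S T.instS = Fintype.card T.S := by congr; exact Subsingleton.elim _ _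
  have htop : LinearMap.range F = ⊤ := by
    apply Submodule.eq_top_of_finrank_eq
    apply le_antisymm (Submodule.finrank_le _)
    rw [Module.finrank_fintype_fun_eq_card, Fintype.card_coe]
    omega
  exact LinearMap.range_eq_top.1 htop

lemma coord_cases {X : Type} [DecidableEq X] {a b e q r : X}
    (E : ∀ x, (if a = x then (1 : ℤ) else 0) + (if b = x then 1 else 0)
      + (if e = x then 1 else 0) - (if q = x then 1 else 0) = if r = x then 2 else 0) :
    (a = r ∧ b = r ∧ q = e ∧ q ≠ r) ∨ (a = r ∧ e = r ∧ q = b ∧ q ≠ r) ∨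
      (b = r ∧ e = r ∧ q = a ∧ q ≠ r) ∨ (a = r ∧ b = r ∧ e = r) := by
  have h1 := E r
  have h2 := E q
  grind

/-- Combinatorial analysis of one row of the (doubled) orthogonal matrix. -/
lemma row_analysis [DecidableEq R] [DecidableEq C] [DecidableEq S] [Fintype R]
    {W : Finset (R × C × S)} (hW : IsPartialLatinSquare W) (r : R) (c : C) (s : S)
    (hn : (r, c, s) ∉ W) (m : R × C × S → ℤ) (hsq : ∑ t ∈ W, m t ^ 2 = 4)
    (hr : ∀ x, ∑ t ∈ W, (if t.1 = x then m t else 0) = if r = x then 2 else 0)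
    (hc : ∀ x, ∑ t ∈ W, (if t.2.1 = x then m t else 0) = if c = x then 2 else 0)
    (hs : ∀ x, ∑ t ∈ W, (if t.2.2 = x then m t else 0) = if s = x then 2 else 0) :
    ∃ r' c' s', r' ≠ r ∧ c' ≠ c ∧ s' ≠ s ∧ (r, c, s') ∈ W ∧ (r, c', s) ∈ W ∧ (r', c, s) ∈ W ∧
      (r', c', s') ∈ W ∧ ∀ t ∈ W, m t = -1 ↔ t = (r', c', s') := by
  have habs : ∀ t ∈ W, m t = 0 ∨ m t = 1 ∨ m t = -1 := by
    intro t ht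
    have hle : m t ^ 2 ≤ 4 := hsq ▸ Finset.single_le_sum (f := fun t => m t ^ 2)
      (fun i _ => sq_nonneg _) ht
    have hlo : -2 ≤ m t := by nlinarith
    have hhi : m t ≤ 2 := by nlinarith
    by_contra hcon
    have h2 : m t ^ 2 = 4 := by
      have : m t = 2 ∨ m t = -2 := by omega
      rcases this with h | h <;> rw [h] <;> norm_num
    have hz : ∀ u ∈ W, u ≠ t → m u = 0 := by
      rw [← Finset.add_sum_erase _ _ ht, h2] at hsq
      have h0 : ∑ u ∈ W.erase t, m u ^ 2 = 0 := by linarith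
      rw [Finset.sum_eq_zero_iff_of_nonneg (fun _ _ => sq_nonneg _)] at h0
      intro u hu hne
      exact pow_eq_zero_iff two_ne_zero |>.1 (h0 u (Finset.mem_erase.2 ⟨hne, hu⟩))
    have k1 : t.1 = r := by
      have := hr r
      rw [Finset.sum_eq_single t (fun u hu hne => by simp [hz u hu hne]) (fun h => absurd ht h)]
        at this
      by_contra hne
      simp [hne] at this
    have k2 : t.2.1 = c := by
      have := hc c
      rw [Finset.sum_eq_single t (fun u hu hne => by simp [hz u hu hne]) (fun h => absurd ht h)]
        at this
      by_contra hne
      simp [hne] at this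
    have k3 : t.2.2 = s := by
      have := hs s
      rw [Finset.sum_eq_single t (fun u hu hne => by simp [hz u hu hne]) (fun h => absurd ht h)]
        at this
      by_contra hne
      simp [hne] at this
    apply hn
    rw [← k1, ← k2, ← k3]
    exact ht
  have hsum : ∑ t ∈ W, m t = 2 := by
    have : ∑ x : R, ∑ t ∈ W, (if t.1 = x then m t else 0) = 2 := by simp [hr]
    rw [Finset.sum_comm] at this
    simpa using this
  have split : ∀ w : R × C × S → ℤ, ∑ t ∈ W, w t * m t =
      ∑ t ∈ W.filter (fun t => m t = 1), w t - ∑ t ∈ W.filter (fun t => m t = -1), w t := by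
    intro w
    rw [Finset.sum_filter, Finset.sum_filter, ← Finset.sum_sub_distrib]
    refine Finset.sum_congr rfl fun t ht => ?_
    rcases habs t ht with h | h | h <;> simp [h]
  have c1 := split (fun _ => 1)
  have c2 := split (fun t => m t)
  have hplus : ∑ t ∈ W.filter (fun t => m t = 1), m t = (W.filter (fun t => m t = 1)).card := by
    rw [Finset.sum_congr rfl (fun t ht => (Finset.mem_filter.1 ht).2)]; simp
  have hminus : ∑ t ∈ W.filter (fun t => m t = -1), m t =
      -((W.filter (fun t => m t = -1)).card : ℤ) := by
    rw [Finset.sum_congr rfl (fun t ht => (Finset.mem_filter.1 ht).2)]; simp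
  rw [hplus, hminus] at c2
  simp only [one_mul, hsum, Finset.sum_const, nsmul_eq_mul, mul_one] at c1
  simp only [← pow_two, hsq] at c2
  have d1 : (W.filter (fun t => m t = 1)).card = 3 := by omega
  have d2 : (W.filter (fun t => m t = -1)).card = 1 := by omega
  obtain ⟨q, hq⟩ := Finset.card_eq_one.1 d2
  obtain ⟨p₁, p₂, p₃, n12, n13, n23, hp⟩ := Finset.card_eq_three.1 d1
  have mq : q ∈ W ∧ m q = -1 := Finset.mem_filter.1 (hq ▸ Finset.mem_singleton_self q)
  have m1 : p₁ ∈ W := by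
    have : p₁ ∈ W.filter (fun t => m t = 1) := by rw [hp]; simp
    exact (Finset.mem_filter.1 this).1
  have m2 : p₂ ∈ W := by
    have : p₂ ∈ W.filter (fun t => m t = 1) := by rw [hp]; simp
    exact (Finset.mem_filter.1 this).1
  have m3 : p₃ ∈ W := by
    have : p₃ ∈ W.filter (fun t => m t = 1) := by rw [hp]; simp
    exact (Finset.mem_filter.1 this).1
  have huniq : ∀ t ∈ W, m t = -1 ↔ t = q := by
    intro t ht
    constructor
    · intro h
      have : t ∈ W.filter (fun t => m t = -1) := Finset.mem_filter.2 ⟨ht, h⟩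
      rw [hq] at this
      exact Finset.mem_singleton.1 this
    · rintro rfl
      exact mq.2
  have split' : ∀ w : R × C × S → ℤ, ∑ t ∈ W, w t * m t = w p₁ + w p₂ + w p₃ - w q := by
    intro w
    rw [split w, hq, hp, Finset.sum_singleton, Finset.sum_insert (by simp [n12, n13]),
      Finset.sum_pair n23, add_assoc]
  have ER : ∀ x, (if p₁.1 = x then (1 : ℤ) else 0) + (if p₂.1 = x then 1 else 0)
      + (if p₃.1 = x then 1 else 0) - (if q.1 = x then 1 else 0) = if r = x then 2 else 0 := by
    intro x
    rw [← hr x, ← split' (fun t => if t.1 = x then 1 else 0)]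
    simp
  have EC : ∀ x, (if p₁.2.1 = x then (1 : ℤ) else 0) + (if p₂.2.1 = x then 1 else 0)
      + (if p₃.2.1 = x then 1 else 0) - (if q.2.1 = x then 1 else 0)
        = if c = x then 2 else 0 := by
    intro x
    rw [← hc x, ← split' (fun t => if t.2.1 = x then 1 else 0)]
    simp
  have ES : ∀ x, (if p₁.2.2 = x then (1 : ℤ) else 0) + (if p₂.2.2 = x then 1 else 0)
      + (if p₃.2.2 = x then 1 else 0) - (if q.2.2 = x then 1 else 0)
        = if s = x then 2 else 0 := by
    intro x
    rw [← hs x, ← split' (fun t => if t.2.2 = x then 1 else 0)]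
    simp
  have l12 := hW.1 p₁ m1 p₂ m2 n12
  have l13 := hW.1 p₁ m1 p₃ m3 n13
  have l23 := hW.1 p₂ m2 p₃ m3 n23
  clear split split' c1 c2 d1 d2 hplus hminus hsum habs hr hc hs hsq hp hq
  obtain ⟨q1, q2, q3⟩ := q
  obtain ⟨a1, a2, a3⟩ := p₁
  obtain ⟨b1, b2, b3⟩ := p₂
  obtain ⟨e1, e2, e3⟩ := p₃
  simp only at *
  refine ⟨q1, q2, q3, ?_⟩
  have FR := coord_cases ER
  have FC := coord_cases EC
  have FS := coord_cases ES
  clear ER EC ES hW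
  rcases FR with ⟨rfl, rfl, rfl, nr⟩ | ⟨rfl, rfl, rfl, nr⟩ | ⟨rfl, rfl, rfl, nr⟩ | ⟨rfl, rfl, rfl⟩ <;>
  rcases FC with ⟨rfl, rfl, rfl, nc⟩ | ⟨rfl, rfl, rfl, nc⟩ | ⟨rfl, rfl, rfl, nc⟩ | ⟨rfl, rfl, rfl⟩ <;>
  first
  | (exfalso; simp at l12; done)
  | (exfalso; simp at l13; done)
  | (exfalso; simp at l23; done)
  | (rcases FS with ⟨rfl, rfl, rfl, ns⟩ | ⟨rfl, rfl, rfl, ns⟩ | ⟨rfl, rfl, rfl, ns⟩ | ⟨rfl, rfl, rfl⟩ <;>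
    first
    | (exfalso; simp at l12; done)
    | (exfalso; simp at l13; done)
    | (exfalso; simp at l23; done)
    | exact ⟨nr, nc, ns, by assumption, by assumption, by assumption, mq.1, huniq⟩)

/-- The element `r + c + s` of the free abelian group. -/
def rel (t : R × C × S) : FreeAbelianGroup (R ⊕ C ⊕ S) :=
  FreeAbelianGroup.of (Sum.inl t.1) +
    FreeAbelianGroup.of (Sum.inr (Sum.inl t.2.1)) +
    FreeAbelianGroup.of (Sum.inr (Sum.inr t.2.2))

/-- Rational coordinates on the free abelian group. -/
noncomputable def coordQ {X : Type} [DecidableEq X] (v : X) : FreeAbelianGroup X →+ ℚ :=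
  FreeAbelianGroup.lift (fun x => if x = v then 1 else 0)

lemma coordQ_rel [DecidableEq R] [DecidableEq C] [DecidableEq S] (t : R × C × S)
    (v : R ⊕ C ⊕ S) : coordQ v (rel t) = inc t v := by
  rcases v with v | v | v <;> simp [coordQ, rel, inc]

lemma coordQ_eq {X : Type} [DecidableEq X] (v : X) (x : FreeAbelianGroup X) :
    coordQ v x = ((FreeAbelianGroup.toFinsupp x v : ℤ) : ℚ) := by
  have : coordQ v = (Int.castAddHom ℚ).comp ((Finsupp.applyAddHom v).comp
      (FreeAbelianGroup.toFinsupp (X := X))) := by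
    ext x
    simp [coordQ, Finsupp.single_apply]
  rw [this]
  rfl

lemma coordQ_ext {X : Type} [DecidableEq X] {x y : FreeAbelianGroup X}
    (h : ∀ v, coordQ v x = coordQ v y) : x = y := by
  apply (FreeAbelianGroup.equivFinsupp X).injective
  ext v
  have := h v
  rw [coordQ_eq, coordQ_eq] at this
  exact_mod_cast this

lemma rel_mem (T : SphericalLatinBitrade) {t : T.R × T.C × T.S} (ht : t ∈ T.W) :
    rel t ∈ bitradeRelations T :=
  AddSubgroup.subset_closure ⟨t, ht, rfl⟩

lemma exists_coeff (T : SphericalLatinBitrade) {x : FreeAbelianGroup (T.R ⊕ T.C ⊕ T.S)}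
    (hx : x ∈ bitradeRelations T) : ∃ n : T.W → ℤ, x = ∑ t, n t • rel t.1 := by
  classical
  refine AddSubgroup.closure_induction (p := fun x _ => ∃ n : T.W → ℤ, x = ∑ t, n t • rel t.1)
    ?_ ?_ ?_ ?_ hx
  · rintro _ ⟨t, ht, rfl⟩
    refine ⟨Pi.single ⟨t, ht⟩ 1, ?_⟩
    rw [Finset.sum_eq_single ⟨t, ht⟩]
    · simp [rel]
    · intro u _ hu
      simp [hu]
    · simp
  · exact ⟨0, by simp⟩
  · rintro _ _ _ _ ⟨n, rfl⟩ ⟨k, rfl⟩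
    exact ⟨n + k, by simp [add_smul, Finset.sum_add_distrib]⟩
  · rintro _ _ ⟨n, rfl⟩
    exact ⟨-n, by simp⟩

lemma exists_matrix (T : SphericalLatinBitrade) [DecidableEq T.R] [DecidableEq T.C]
    [DecidableEq T.S] [Fintype T.R] [Fintype T.C] [Fintype T.S]
    (h2 : ∀ x : groupAW T, x ∈ AddCommGroup.torsion (groupAW T) → 2 • x = 0) :
    ∃ (M : Matrix T.B T.W ℚ) (m : T.B → T.W → ℤ), (∀ b a, 2 * M b a = m b a) ∧
      M.transpose * M = 1 ∧ M * incMat T.W = incMat T.B ∧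
      M.transpose * incMat T.B = incMat T.W ∧
      ∀ b : T.B, 2 • rel b.1 ∈ bitradeRelations T := by
  obtain ⟨P, hP⟩ := exists_right_inv T
  have hg := gram_eq T.W_pls T.B_pls T.tradeWB T.tradeBW
  have hM : incMat T.B * P * incMat T.W = incMat T.B := by
    have key : ∀ f, (incMat T.W).mulVec f = 0 → (incMat T.B).mulVec f = 0 := by
      intro f hf
      have := black_zero T (fun r => f (Sum.inl r)) (fun c => f (Sum.inr (Sum.inl c)))
        (fun s => f (Sum.inr (Sum.inr s))) (fun t ht => by
          rw [← incMat_mulVec T.W f ⟨t, ht⟩, hf]; rfl)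
      ext t
      rw [incMat_mulVec]
      exact this t.1 t.2
    apply Matrix.ext_of_mulVec_single
    intro i
    have h := key ((P * incMat T.W).mulVec (Pi.single i 1) - Pi.single i 1) (by
      rw [Matrix.mulVec_sub, Matrix.mulVec_mulVec, ← Matrix.mul_assoc, hP, Matrix.one_mul, sub_self])
    rw [Matrix.mulVec_sub, Matrix.mulVec_mulVec, ← Matrix.mul_assoc, sub_eq_zero] at h
    exact h
  have hMM : (incMat T.B * P).transpose * (incMat T.B * P) = 1 := by
    rw [Matrix.transpose_mul, Matrix.mul_assoc, ← Matrix.mul_assoc _ (incMat T.B) P, ← hg,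
      Matrix.mul_assoc, hP, Matrix.mul_one, ← Matrix.transpose_mul, hP, Matrix.transpose_one]
  have hMB : (incMat T.B * P).transpose * incMat T.B = incMat T.W := by
    rw [Matrix.transpose_mul, Matrix.mul_assoc, ← hg, ← Matrix.mul_assoc, ← Matrix.transpose_mul,
      hP, Matrix.transpose_one, Matrix.one_mul]
  generalize hMdef : incMat T.B * P = M at *
  have hMv : ∀ b v, ∑ a, M b a * inc a.1 v = inc b.1 v := by
    intro b v
    exact congrFun (congrFun hM b) v
  have htwo : ∀ b : T.B, 2 • rel b.1 ∈ bitradeRelations T := by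
    intro b
    have hN : ∃ (N : ℕ) (k : T.W → ℤ), N ≠ 0 ∧ ∀ a, (N : ℚ) * M b a = k a := by
      refine ⟨∏ a, (M b a).den, fun a => (∏ a' ∈ Finset.univ.erase a, (M b a').den) * (M b a).num,
        Finset.prod_ne_zero_iff.2 fun a _ => (M b a).den_nz, fun a => ?_⟩
      rw [← Finset.prod_erase_mul _ _ (Finset.mem_univ a)]
      push_cast
      rw [mul_assoc, Rat.den_mul_eq_num]
    obtain ⟨N, k, hN0, hk⟩ := hN
    have hrel : N • rel b.1 = ∑ a, k a • rel a.1 := by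
      apply coordQ_ext
      intro v
      rw [map_nsmul, map_sum, coordQ_rel, ← hMv b v, nsmul_eq_mul, Finset.mul_sum]
      refine Finset.sum_congr rfl fun a _ => ?_
      rw [map_zsmul, coordQ_rel, zsmul_eq_mul, ← hk a, mul_assoc]
    have hmem : N • rel b.1 ∈ bitradeRelations T := by
      rw [hrel]
      exact AddSubgroup.sum_mem _ fun a _ => AddSubgroup.zsmul_mem _ (rel_mem T a.2) _
    have ht : (QuotientAddGroup.mk (rel b.1) : groupAW T) ∈ AddCommGroup.torsion (groupAW T) := by
      change IsOfFinAddOrder _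
      rw [isOfFinAddOrder_iff_nsmul_eq_zero]
      exact ⟨N, Nat.pos_of_ne_zero hN0, (QuotientAddGroup.eq_zero_iff _).2 hmem⟩
    exact (QuotientAddGroup.eq_zero_iff _).1 (h2 _ ht)
  have hint : ∀ b : T.B, ∃ n : T.W → ℤ, ∀ a, 2 * M b a = n a := by
    intro b
    obtain ⟨n, hn⟩ := exists_coeff T (htwo b)
    refine ⟨n, ?_⟩
    have e : Matrix.vecMul (fun a => 2 * M b a - n a) (incMat T.W) = 0 := by
      ext v
      have h := congrArg (coordQ v) hn
      rw [map_nsmul, map_sum, coordQ_rel, ← hMv b v, nsmul_eq_mul, Finset.mul_sum] at h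
      simp only [map_zsmul, coordQ_rel, zsmul_eq_mul] at h
      change ∑ a, (2 * M b a - n a) * inc a.1 v = 0
      simp only [sub_mul, Finset.sum_sub_distrib, ← h]
      simp [mul_assoc]
    have e2 := congrArg (fun w => Matrix.vecMul w P) e
    simp only [Matrix.vecMul_vecMul, hP, Matrix.vecMul_one, Matrix.zero_vecMul] at e2
    intro a
    exact sub_eq_zero.1 (congrFun e2 a)
  choose m hm using hint
  exact ⟨M, m, hm, hMM, hM, hMB, htwo⟩

lemma exists_intercalate (T : SphericalLatinBitrade)
    (h2 : ∀ x : groupAW T, x ∈ AddCommGroup.torsion (groupAW T) → 2 • x = 0) :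
    ∃ r c s r' c' s', 2 • rel (r, c, s) ∈ bitradeRelations T ∧
      (r, c, s') ∈ T.W ∧ (r, c', s) ∈ T.W ∧ (r', c, s) ∈ T.W ∧ (r', c', s') ∈ T.W ∧
      (r', c', s) ∈ T.B ∧ (r', c, s') ∈ T.B ∧ (r, c', s') ∈ T.B ∧ (r, c, s) ∈ T.B := by
  classical
  let _ := T.instR
  let _ := T.instC
  let _ := T.instS
  obtain ⟨M, m, hm, hMM, hMW, hMB, htwo⟩ := exists_matrix T h2
  have hcard : T.W.card = T.B.card := by
    have := sum_rc T.W_pls T.B_pls T.tradeWB T.tradeBW (fun _ _ => 1)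
    simp at this
    exact_mod_cast this
  have hMM' : M * M.transpose = 1 := by
    have e : T.W ≃ T.B := Fintype.equivOfCardEq (by simpa using hcard)
    exact (Matrix.mul_eq_one_comm_of_equiv e).1 hMM
  have hrow : ∀ b : T.B, ∃ r' c' s', r' ≠ b.1.1 ∧ c' ≠ b.1.2.1 ∧ s' ≠ b.1.2.2 ∧
      (b.1.1, b.1.2.1, s') ∈ T.W ∧ (b.1.1, c', b.1.2.2) ∈ T.W ∧ (r', b.1.2.1, b.1.2.2) ∈ T.W ∧
      (r', c', s') ∈ T.W ∧
      ∀ t ∈ T.W, (if h : t ∈ T.W then m b ⟨t, h⟩ else 0) = -1 ↔ t = (r', c', s') := by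
    intro b
    have hsum : ∀ g : T.R × T.C × T.S → ℤ → ℤ,
        ∑ t ∈ T.W, g t (if h : t ∈ T.W then m b ⟨t, h⟩ else 0) = ∑ a : T.W, g a.1 (m b a) := by
      intro g
      rw [← Finset.sum_coe_sort T.W]
      exact Finset.sum_congr rfl fun a _ => by simp
    have hv : ∀ v, ∑ a : T.W, (m b a : ℚ) * inc a.1 v = 2 * inc b.1 v := by
      intro v
      have : ∑ a, M b a * inc a.1 v = inc b.1 v := congrFun (congrFun hMW b) v
      rw [← this, Finset.mul_sum]
      exact Finset.sum_congr rfl fun a _ => by rw [← hm, mul_assoc]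
    refine row_analysis T.W_pls b.1.1 b.1.2.1 b.1.2.2 ?_ _ ?_ ?_ ?_ ?_
    · intro hmem
      obtain ⟨x, ⟨hx, hxB⟩, -⟩ := T.tradeWB _ hmem
      obtain ⟨x, ⟨hx, hxB⟩, -⟩ := (T.tradeWB _ hmem).1
      exact (T.B_pls.1 _ hxB b.1 b.2 (fun h => hx (congrArg Prod.fst h))).2.2 ⟨rfl, rfl⟩
    · rw [hsum (fun _ z => z ^ 2)]
      have : ∑ a, M b a * M b a = 1 := by
        have := congrFun (congrFun hMM' b) b
        simpa [Matrix.mul_apply] using this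
      have h4 : ∑ a, ((m b a : ℚ)) ^ 2 = 4 := by
        rw [show (4 : ℚ) = 4 * 1 by norm_num, ← this, Finset.mul_sum]
        exact Finset.sum_congr rfl fun a _ => by rw [← hm]; ring
      exact_mod_cast h4
    · intro x
      rw [hsum (fun t z => if t.1 = x then z else 0)]
      have := hv (Sum.inl x)
      simp only [inc, Sum.elim_inl, mul_ite, mul_one, mul_zero] at this
      exact_mod_cast this
    · intro x
      rw [hsum (fun t z => if t.2.1 = x then z else 0)]
      have := hv (Sum.inr (Sum.inl x))
      simp only [inc, Sum.elim_inl, Sum.elim_inr, mul_ite, mul_one, mul_zero] at this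
      exact_mod_cast this
    · intro x
      rw [hsum (fun t z => if t.2.2 = x then z else 0)]
      have := hv (Sum.inr (Sum.inr x))
      simp only [inc, Sum.elim_inr, mul_ite, mul_one, mul_zero] at this
      exact_mod_cast this
  have hcol : ∀ a : T.W, ∃ r' c' s', r' ≠ a.1.1 ∧ c' ≠ a.1.2.1 ∧ s' ≠ a.1.2.2 ∧
      (a.1.1, a.1.2.1, s') ∈ T.B ∧ (a.1.1, c', a.1.2.2) ∈ T.B ∧ (r', a.1.2.1, a.1.2.2) ∈ T.B ∧
      (r', c', s') ∈ T.B ∧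
      ∀ t ∈ T.B, (if h : t ∈ T.B then m ⟨t, h⟩ a else 0) = -1 ↔ t = (r', c', s') := by
    intro a
    have hsum : ∀ g : T.R × T.C × T.S → ℤ → ℤ,
        ∑ t ∈ T.B, g t (if h : t ∈ T.B then m ⟨t, h⟩ a else 0) = ∑ b : T.B, g b.1 (m b a) := by
      intro g
      rw [← Finset.sum_coe_sort T.B]
      exact Finset.sum_congr rfl fun a _ => by simp
    have hv : ∀ v, ∑ b : T.B, (m b a : ℚ) * inc b.1 v = 2 * inc a.1 v := by
      intro v
      have : ∑ b, M b a * inc b.1 v = inc a.1 v := congrFun (congrFun hMB a) v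
      rw [← this, Finset.mul_sum]
      exact Finset.sum_congr rfl fun b _ => by rw [← hm, mul_assoc]
    refine row_analysis T.B_pls a.1.1 a.1.2.1 a.1.2.2 ?_ _ ?_ ?_ ?_ ?_
    · intro hmem
      obtain ⟨x, ⟨hx, hxW⟩, -⟩ := (T.tradeBW _ hmem).1
      exact (T.W_pls.1 _ hxW a.1 a.2 (fun h => hx (congrArg Prod.fst h))).2.2 ⟨rfl, rfl⟩
    · rw [hsum (fun _ z => z ^ 2)]
      have : ∑ b, M b a * M b a = 1 := by
        have := congrFun (congrFun hMM a) a
        simpa [Matrix.mul_apply] using this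
      have h4 : ∑ b, ((m b a : ℚ)) ^ 2 = 4 := by
        rw [show (4 : ℚ) = 4 * 1 by norm_num, ← this, Finset.mul_sum]
        exact Finset.sum_congr rfl fun b _ => by rw [← hm]; ring
      exact_mod_cast h4
    · intro x
      rw [hsum (fun t z => if t.1 = x then z else 0)]
      have := hv (Sum.inl x)
      simp only [inc, Sum.elim_inl, mul_ite, mul_one, mul_zero] at this
      exact_mod_cast this
    · intro x
      rw [hsum (fun t z => if t.2.1 = x then z else 0)]
      have := hv (Sum.inr (Sum.inl x))
      simp only [inc, Sum.elim_inl, Sum.elim_inr, mul_ite, mul_one, mul_zero] at this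
      exact_mod_cast this
    · intro x
      rw [hsum (fun t z => if t.2.2 = x then z else 0)]
      have := hv (Sum.inr (Sum.inr x))
      simp only [inc, Sum.elim_inr, mul_ite, mul_one, mul_zero] at this
      exact_mod_cast this
  obtain ⟨⟨r, c, s⟩, hb⟩ := T.B_nonempty
  obtain ⟨r', c', s', -, -, -, w1, w2, w3, w4, hu⟩ := hrow ⟨_, hb⟩
  obtain ⟨x, y, z, -, -, -, b1, b2, b3, b4, hu'⟩ := hcol ⟨_, w4⟩
  have e1 := (hu _ w4).2 rfl
  rw [dif_pos w4] at e1
  have e2 := (hu' _ hb).1 (by rw [dif_pos hb]; exact e1)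
  simp only [Prod.mk.injEq] at e2
  obtain ⟨rfl, rfl, rfl⟩ := e2
  exact ⟨r, c, s, r', c', s', htwo ⟨_, hb⟩, w1, w2, w3, w4, b1, b2, b3, hb⟩

lemma all_in_intercalate (T : SphericalLatinBitrade) {r c s r' c' s'}
    (w1 : (r, c, s') ∈ T.W) (w2 : (r, c', s) ∈ T.W) (w3 : (r', c, s) ∈ T.W)
    (w4 : (r', c', s') ∈ T.W) (b1 : (r', c', s) ∈ T.B) (b2 : (r', c, s') ∈ T.B)
    (b3 : (r, c', s') ∈ T.B) (b4 : (r, c, s) ∈ T.B) :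
    ∀ t ∈ T.W, (t.1 = r ∨ t.1 = r') ∧ (t.2.1 = c ∨ t.2.1 = c') ∧ (t.2.2 = s ∨ t.2.2 = s') := by
  have det : ∀ P : Finset (T.R × T.C × T.S), IsPartialLatinSquare P → ∀ t ∈ P, ∀ u ∈ P,
      Adj2 t u → t = u := by
    intro P hP t ht u hu hadj
    by_contra hne
    have := hP.1 t ht u hu hne
    unfold Adj2 at hadj
    tauto
  refine all_of_connected T (fun t => (t.1 = r ∨ t.1 = r') ∧ (t.2.1 = c ∨ t.2.1 = c') ∧
    (t.2.2 = s ∨ t.2.2 = s')) ?_ (r, c, s') w1 (by simp)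
  intro t ht u hu hadj
  have dB : ∀ v ∈ T.B, Adj2 v u → v = u := fun v hv h => det _ T.B_pls v hv u hu h
  have dW : ∀ v ∈ T.W, Adj2 v t → v = t := fun v hv h => det _ T.W_pls v hv t ht h
  have B1 := dB _ b1
  have B2 := dB _ b2
  have B3 := dB _ b3
  have B4 := dB _ b4
  have W1 := dW _ w1
  have W2 := dW _ w2
  have W3 := dW _ w3
  have W4 := dW _ w4
  clear dB dW det ht hu w1 w2 w3 w4 b1 b2 b3 b4
  obtain ⟨t1, t2, t3⟩ := t
  obtain ⟨u1, u2, u3⟩ := u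
  simp only [Adj2, Prod.mk.injEq] at *
  rcases hadj with ⟨rfl, rfl⟩ | ⟨rfl, rfl⟩ | ⟨rfl, rfl⟩
  · constructor
    · clear W1 W2 W3 W4
      grind
    · clear B1 B2 B3 B4
      grind
  · constructor
    · clear W1 W2 W3 W4
      grind
    · clear B1 B2 B3 B4
      grind
  · constructor
    · clear W1 W2 W3 W4
      grind
    · clear B1 B2 B3 B4
      grind

/-- The grading homomorphism sending rows to `x`, columns to `y`, symbols to `z`. -/
noncomputable def gradeHom (T : SphericalLatinBitrade) (x y z : ℤ) (h : x + y + z = 0) :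
    groupAW T →+ ℤ :=
  QuotientAddGroup.lift (bitradeRelations T)
    (FreeAbelianGroup.lift (Sum.elim (fun _ => x) (Sum.elim (fun _ => y) (fun _ => z)))) (by
      rw [bitradeRelations, AddSubgroup.closure_le]
      rintro _ ⟨t, -, rfl⟩
      simp [h])

lemma torsion_small (T : SphericalLatinBitrade) {r c s r' c' s'}
    (h2 : 2 • rel (r, c, s) ∈ bitradeRelations T)
    (w1 : (r, c, s') ∈ T.W) (w2 : (r, c', s) ∈ T.W) (w3 : (r', c, s) ∈ T.W)
    (hall : ∀ t ∈ T.W, (t.1 = r ∨ t.1 = r') ∧ (t.2.1 = c ∨ t.2.1 = c') ∧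
      (t.2.2 = s ∨ t.2.2 = s'))
    (x : groupAW T) (hx : x ∈ AddCommGroup.torsion (groupAW T)) :
    x = 0 ∨ x = QuotientAddGroup.mk (rel (r, c, s)) := by
  let π : FreeAbelianGroup (T.R ⊕ T.C ⊕ T.S) →+ groupAW T :=
    QuotientAddGroup.mk' (bitradeRelations T)
  have hπ : ∀ t ∈ T.W, π (rel t) = 0 := fun t ht => (QuotientAddGroup.eq_zero_iff _).2 (rel_mem T ht)
  let a := π (.of (Sum.inl r))
  let b := π (.of (Sum.inr (Sum.inl c)))
  let d := π (.of (Sum.inr (Sum.inr s)))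
  have k1 : a + b + π (.of (Sum.inr (Sum.inr s'))) = 0 := by simpa [rel, a, b] using hπ _ w1
  have k2 : a + π (.of (Sum.inr (Sum.inl c'))) + d = 0 := by simpa [rel, a, d] using hπ _ w2
  have k3 : π (.of (Sum.inl r')) + b + d = 0 := by simpa [rel, b, d] using hπ _ w3
  have hgen : ∀ y : FreeAbelianGroup (T.R ⊕ T.C ⊕ T.S), ∃ i j k : ℤ,
      π y = i • a + j • b + k • d := by
    intro y
    induction y using FreeAbelianGroup.induction_on with
    | zero => exact ⟨0, 0, 0, by simp⟩
    | of v =>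
      rcases v with v | v | v
      · obtain ⟨t, ht, rfl⟩ := T.W_pls.2.1 v
        rcases (hall t ht).1 with h | h <;> rw [h]
        · exact ⟨1, 0, 0, by simp [a]⟩
        · refine ⟨0, -1, -1, ?_⟩
          rw [add_assoc] at k3
          rw [eq_neg_of_add_eq_zero_left k3]
          module
      · obtain ⟨t, ht, rfl⟩ := T.W_pls.2.2.1 v
        rcases (hall t ht).2.1 with h | h <;> rw [h]
        · exact ⟨0, 1, 0, by simp [b]⟩
        · refine ⟨-1, 0, -1, ?_⟩
          rw [add_right_comm] at k2
          rw [eq_neg_of_add_eq_zero_right k2]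
          module
      · obtain ⟨t, ht, rfl⟩ := T.W_pls.2.2.2 v
        rcases (hall t ht).2.2 with h | h <;> rw [h]
        · exact ⟨0, 0, 1, by simp [d]⟩
        · refine ⟨-1, -1, 0, ?_⟩
          rw [eq_neg_of_add_eq_zero_right k1]
          module
    | neg v ih =>
      obtain ⟨i, j, k, h⟩ := ih
      exact ⟨-i, -j, -k, by rw [map_neg, h]; module⟩
    | add y z ihy ihz =>
      obtain ⟨i, j, k, h⟩ := ihy
      obtain ⟨i', j', k', h'⟩ := ihz
      exact ⟨i + i', j + j', k + k', by rw [map_add, h, h']; module⟩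
  obtain ⟨y, rfl⟩ := QuotientAddGroup.mk_surjective x
  obtain ⟨i, j, k, hy⟩ := hgen y
  have hfin : ∀ φ : groupAW T →+ ℤ, φ (π y) = 0 := by
    intro φ
    have hx' : IsOfFinAddOrder (π y) := hx
    rw [isOfFinAddOrder_iff_nsmul_eq_zero] at hx'
    obtain ⟨n, hn, hny⟩ := hx'
    have := congrArg φ hny
    rw [map_nsmul, map_zero, nsmul_eq_mul] at this
    rcases mul_eq_zero.1 this with h | h
    · exact absurd (by exact_mod_cast h) hn.ne'
    · exact h
  have g1 := hfin (gradeHom T 1 (-1) 0 (by norm_num))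
  have g2 := hfin (gradeHom T 1 0 (-1) (by norm_num))
  have ga : ∀ p q u h, gradeHom T p q u h a = p := by
    intro p q u h
    change FreeAbelianGroup.lift _ _ = _
    simp
  have gb : ∀ p q u h, gradeHom T p q u h b = q := by
    intro p q u h
    change FreeAbelianGroup.lift _ _ = _
    simp
  have gd : ∀ p q u h, gradeHom T p q u h d = u := by
    intro p q u h
    change FreeAbelianGroup.lift _ _ = _
    simp
  rw [hy, map_add, map_add, map_zsmul, map_zsmul, map_zsmul, ga, gb, gd] at g1 g2
  simp only [smul_eq_mul] at g1 g2
  have hj : j = i := by linarith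
  have hk : k = i := by linarith
  subst hj hk
  have hβ : (QuotientAddGroup.mk (rel (r, c, s)) : groupAW T) = a + b + d := rfl
  have h2' : (2 : ℤ) • (a + b + d) = 0 := by
    have : 2 • (QuotientAddGroup.mk (rel (r, c, s)) : groupAW T) = 0 :=
      (QuotientAddGroup.eq_zero_iff _).2 h2
    rw [hβ] at this
    rw [← this]
    module
  rw [hβ]
  change π y = 0 ∨ π y = _
  rw [hy]
  rcases Int.even_or_odd' k with ⟨n, hn | hn⟩
  · left
    calc k • a + k • b + k • d = n • ((2 : ℤ) • (a + b + d)) := by rw [hn]; module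
      _ = 0 := by rw [h2', smul_zero]
  · right
    calc k • a + k • b + k • d = n • ((2 : ℤ) • (a + b + d)) + (a + b + d) := by rw [hn]; module
      _ = a + b + d := by rw [h2', smul_zero, zero_add]

end Helpers

/-- For every integer `k ≥ 2`, there is no spherical latin bitrade whose canonical group is
isomorphic to `(ℤ/2ℤ)^k`. -/
theorem no_spherical_bitrade_with_canonical_group_Z2_pow (k : ℕ) (hk : 2 ≤ k) :
    ¬ ∃ T : SphericalLatinBitrade,
        Nonempty (CanonicalGroup T ≃+ (Fin k → ZMod 2)) := by
  rintro ⟨T, ⟨e⟩⟩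
  have h2 : ∀ x : groupAW T, x ∈ AddCommGroup.torsion (groupAW T) → 2 • x = 0 := by
    intro x hx
    have h : 2 • (⟨x, hx⟩ : CanonicalGroup T) = 0 := by
      apply e.injective
      rw [map_nsmul, map_zero]
      ext i
      rw [Pi.smul_apply, two_nsmul]
      exact CharTwo.add_self_eq_zero _
    exact congrArg Subtype.val h
  obtain ⟨r, c, s, r', c', s', hr, w1, w2, w3, w4, b1, b2, b3, b4⟩ := exists_intercalate T h2
  have hall := all_in_intercalate T w1 w2 w3 w4 b1 b2 b3 b4
  have hsmall := torsion_small T hr w1 w2 w3 hall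
  have key : ∀ f : Fin k → ZMod 2, f ≠ 0 →
      (e.symm f : groupAW T) = QuotientAddGroup.mk (rel (r, c, s)) := by
    intro f hf
    rcases hsmall _ (e.symm f).2 with h | h
    · exact absurd (e.symm.map_eq_zero_iff.1 (Subtype.ext h)) hf
    · exact h
  let i0 : Fin k := ⟨0, by omega⟩
  let i1 : Fin k := ⟨1, by omega⟩
  have n0 : (Pi.single i0 1 : Fin k → ZMod 2) ≠ 0 := by simp
  have n1 : (Pi.single i1 1 : Fin k → ZMod 2) ≠ 0 := by simp
  have heq : (Pi.single i0 1 : Fin k → ZMod 2) = Pi.single i1 1 :=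
    e.symm.injective (Subtype.ext ((key _ n0).trans (key _ n1).symm))
  have := congrFun heq i0
  rw [Pi.single_eq_same, Pi.single_eq_of_ne (by simp [i0, i1])] at this
  exact one_ne_zero this
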